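/- If F is a finite automaton (Mealy machine) with input alphabet A and output alphabet B, and ω is an almost periodic sequence over A, then the output sequence F(ω) is almost periodic over B. -/

import Mathlib

/-- The segment of a sequence `ω` of length `l` starting at position `i`,
i.e. the string `ω(i)ω(i+1)…ω(i+l-1)`. -/
def seg {A : Type*} (ω : ℕ → A) (i l : ℕ) : List A :=
  List.ofFn (fun k : Fin l => ω (i + k))

/-- The string `x` occurs in the sequence `ω` starting at position `i`. -/
def OccursAt {A : Type*} (ω : ℕ → A) (x : List A) (i : ℕ) : Prop :=
  seg ω i x.length = x

/-- A sequence is almost periodic if every string occurring in it infinitely many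
times occurs in every segment of some fixed length `l`. -/
def AlmostPeriodic {A : Type*} (ω : ℕ → A) : Prop :=
  ∀ x : List A, (∀ N, ∃ i, N ≤ i ∧ OccursAt ω x i) →
    ∃ l, ∀ i, ∃ j, i ≤ j ∧ j + x.length ≤ i + l ∧ OccursAt ω x j

/-- The state of the automaton with translation function `f` and initial state `init`
before reading the `n`-th symbol of the input sequence `α`. -/
def autState {A Q B : Type*} (f : Q × A → Q × B) (init : Q) (α : ℕ → A) : ℕ → Q
  | 0 => init
  | n + 1 => (f (autState f init α n, α n)).1

/-- The output sequence of the finite automaton with translation function `f` and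
initial state `init` on the input sequence `α`. -/
def autOutput {A Q B : Type*} (f : Q × A → Q × B) (init : Q) (α : ℕ → A) (n : ℕ) : B :=
  (f (autState f init α n, α n)).2

/-- The string `x` occurs in `ω` at arbitrarily large positions. -/
def Recurrent {A : Type*} (ω : ℕ → A) (x : List A) : Prop :=
  ∀ N, ∃ i, N ≤ i ∧ OccursAt ω x i

theorem occursAt_iff {A : Type*} {ω : ℕ → A} {x : List A} {i : ℕ} :
    OccursAt ω x i ↔ ∀ (k : ℕ) (h : k < x.length), ω (i + k) = x[k] := by
  unfold OccursAt seg
  constructor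
  · intro h k hk
    have h' := congrArg (fun l : List A => l[k]?) h
    simpa [hk] using h'
  · intro h
    apply List.ext_getElem
    · simp
    · intro k _ hk
      simpa using h k hk

theorem occursAt_seg_iff {A : Type*} {ω : ℕ → A} {n m i : ℕ} :
    OccursAt ω (seg ω n m) i ↔ ∀ k < m, ω (i + k) = ω (n + k) := by
  rw [occursAt_iff]
  simp [seg]

/-- Occurrence of a string only depends on the symbols it covers. -/
theorem OccursAt.congr {A : Type*} {α β : ℕ → A} {x : List A} {i j : ℕ}
    (hx : OccursAt α x i) (h : ∀ k < x.length, β (j + k) = α (i + k)) : OccursAt β x j := by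
  rw [occursAt_iff] at hx ⊢
  intro k hk
  rw [h k hk, hx k hk]

theorem autState_add {A Q B : Type*} (f : Q × A → Q × B) (init : Q) (α : ℕ → A) (n m : ℕ) :
    autState f init α (n + m) =
      autState f (autState f init α n) (fun k => α (n + k)) m := by
  induction m with
  | zero => rfl
  | succ m ih => rw [← add_assoc, autState, autState, ih]

theorem autOutput_add {A Q B : Type*} (f : Q × A → Q × B) (init : Q) (α : ℕ → A) (n m : ℕ) :
    autOutput f init α (n + m) =
      autOutput f (autState f init α n) (fun k => α (n + k)) m := by
  rw [autOutput, autOutput, autState_add]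

theorem autState_congr {A Q B : Type*} (f : Q × A → Q × B) (init : Q) {α β : ℕ → A} {m : ℕ}
    (h : ∀ k < m, α k = β k) : autState f init α m = autState f init β m := by
  induction m with
  | zero => rfl
  | succ m ih =>
    rw [autState, autState, ih fun k hk => h k (by omega), h m (by omega)]

theorem autOutput_congr {A Q B : Type*} (f : Q × A → Q × B) (init : Q) {α β : ℕ → A} {m : ℕ}
    (h : ∀ k ≤ m, α k = β k) : autOutput f init α m = autOutput f init β m := by
  rw [autOutput, autOutput, autState_congr f init fun k hk => h k hk.le, h m le_rfl]

/-- Pigeonhole principle for an antitone family of properties on a finite type. -/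
theorem exists_forall_of_forall_exists_of_antitone {Q : Type*} [Finite Q] {P : Q → ℕ → Prop}
    (hP : ∀ r k l, k ≤ l → P r l → P r k) (h : ∀ k, ∃ r, P r k) : ∃ r, ∀ k, P r k := by
  have := Fintype.ofFinite Q
  by_contra! hc
  choose K hK using hc
  obtain ⟨r, hr⟩ := h (Finset.univ.sup K)
  exact hK r (hP r _ _ (Finset.le_sup (Finset.mem_univ r)) hr)

/-- All factors of a given length are recurrent from some position on. -/
theorem exists_forall_recurrent_seg {A : Type*} [Finite A] (ω : ℕ → A) (m : ℕ) :
    ∃ N, ∀ n ≥ N, Recurrent ω (seg ω n m) := by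
  by_contra! hc
  obtain ⟨g, hg⟩ := exists_forall_of_forall_exists_of_antitone
    (P := fun (g : Fin m → A) N =>
      ∃ n ≥ N, seg ω n m = List.ofFn g ∧ ¬ Recurrent ω (List.ofFn g))
    (fun g k l hkl ⟨n, hn, h⟩ => ⟨n, hkl.trans hn, h⟩)
    (fun N => by
      obtain ⟨n, hn, h⟩ := hc N
      exact ⟨fun k => ω (n + k), n, hn, rfl, h⟩)
  obtain ⟨_, _, _, hrec⟩ := hg 0
  refine hrec fun N => ?_
  obtain ⟨n, hn, h, _⟩ := hg N
  refine ⟨n, hn, ?_⟩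
  rw [OccursAt, List.length_ofFn, h]

/-- The states `r` such that, at arbitrarily late occurrences of `v` in `ω`, the automaton started
in state `r` avoids `y` in its output for arbitrarily long. -/
def avoidingStates {A B Q : Type*} (f : Q × A → Q × B) (ω : ℕ → A) (y : List B)
    (v : List A) : Set Q :=
  {r | ∀ k, ∃ n ≥ k, OccursAt ω v n ∧
    ∀ j < k, ¬ OccursAt (autOutput f r fun m => ω (n + m)) y j}

/-- If the output string `y` fails to occur with bounded gaps, then at some arbitrarily late
occurrence of any recurrent input string the current state is an avoiding state. -/
theorem exists_autState_mem_avoidingStates {A B Q : Type*} [Finite Q] {f : Q × A → Q × B}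
    {init : Q} {ω : ℕ → A} (hω : AlmostPeriodic ω) {y : List B}
    (hy : ∀ l, ∃ i, ∀ j, i ≤ j → j + y.length ≤ i + l → ¬ OccursAt (autOutput f init ω) y j)
    {v : List A} (hv : Recurrent ω v) (N : ℕ) :
    ∃ n ≥ N, OccursAt ω v n ∧ autState f init ω n ∈ avoidingStates f ω y v := by
  obtain ⟨L, hL⟩ := hω v hv
  obtain ⟨r, hr⟩ := exists_forall_of_forall_exists_of_antitone
    (P := fun r k => ∃ n ≥ k, OccursAt ω v n ∧ autState f init ω n = r ∧
      ∀ j < k, ¬ OccursAt (autOutput f r fun m => ω (n + m)) y j)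
    (fun r k l hkl ⟨n, hn, h1, h2, h3⟩ =>
      ⟨n, hkl.trans hn, h1, h2, fun j hj => h3 j (hj.trans_le hkl)⟩)
    (fun k => by
      obtain ⟨i, hi⟩ := hy (k + L + k + y.length)
      obtain ⟨n, hn, hnL, hvn⟩ := hL (i + k)
      refine ⟨_, n, by omega, hvn, rfl, fun j hj hyj => ?_⟩
      refine hi (n + j) (by omega) (by omega) (hyj.congr fun t _ => ?_)
      rw [add_assoc, autOutput_add])
  obtain ⟨n, hn, hvn, hnr, -⟩ := hr N
  refine ⟨n, hn, hvn, fun k => ?_⟩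
  obtain ⟨n', hn', hvn', -, h⟩ := hr k
  exact ⟨n', hn', hvn', hnr ▸ h⟩

/-- If the current state is avoiding for the input factor of length `M` ahead, then
`y` does not occur in the output shortly after, and every occurrence of `v` in this
factor is reached in an avoiding state for `v`. -/
theorem avoidingStates_step {A B Q : Type*} {f : Q × A → Q × B} {init : Q} {ω : ℕ → A}
    {y : List B} {v : List A} {n d M : ℕ}
    (h : autState f init ω n ∈ avoidingStates f ω y (seg ω n M))
    (hv : OccursAt ω v (n + d)) (hvM : d + v.length ≤ M) (hyM : d + y.length ≤ M) :
    autState f init ω (n + d) ∈ avoidingStates f ω y v ∧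
      ∀ t < d, ¬ OccursAt (autOutput f init ω) y (n + t) := by
  constructor
  · intro k
    obtain ⟨i, hi, hw, hav⟩ := h (k + d)
    rw [occursAt_seg_iff] at hw
    refine ⟨i + d, by omega, hv.congr fun t ht => ?_, fun j hj hyj => ?_⟩
    · rw [add_assoc, hw _ (by omega), add_assoc]
    · refine hav (d + j) (by omega) (hyj.congr fun t _ => ?_)
      have hs : autState f (autState f init ω n) (fun m => ω (i + m)) d =
          autState f init ω (n + d) := by
        rw [autState_add]
        exact autState_congr f _ fun k hk => hw k (by omega)
      rw [add_assoc, autOutput_add, hs]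
      simp only [add_assoc]
  · intro t ht hyt
    obtain ⟨i, -, hw, hav⟩ := h d
    rw [occursAt_seg_iff] at hw
    refine hav t ht (hyt.congr fun k hk => ?_)
    rw [add_assoc, autOutput_add f init ω n]
    exact autOutput_congr f _ fun s hs => hw s (by omega)

theorem avoidingStates_seg_subset {A B Q : Type*} {f : Q × A → Q × B} {ω : ℕ → A}
    {y : List B} {v : List A} {n M : ℕ} (hv : OccursAt ω v n) (hM : v.length ≤ M) :
    avoidingStates f ω y (seg ω n M) ⊆ avoidingStates f ω y v := by
  intro r hr k
  obtain ⟨i, hi, hw, hav⟩ := hr k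
  rw [occursAt_seg_iff] at hw
  exact ⟨i, hi, hv.congr fun t ht => hw t (by omega), hav⟩

/-- If `F` is a finite automaton with input alphabet `A` and output alphabet `B`, and `ω`
is an almost periodic sequence over `A`, then the output `F(ω)` is an almost periodic
sequence over `B`. -/
theorem automaton_preserves_almostPeriodic {A B : Type*} [Fintype A] [Fintype B]
    (Q : Type*) [Fintype Q] (f : Q × A → Q × B) (init : Q)
    (ω : ℕ → A) (hω : AlmostPeriodic ω) :
    AlmostPeriodic (autOutput f init ω) := by
  intro y hyrec
  by_contra! hy
  obtain ⟨v, hv, hmin⟩ := (measure fun v : List A => (avoidingStates f ω y v).ncard).wf.has_min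
    {v | Recurrent ω v} ⟨[], fun N => ⟨N, le_rfl, rfl⟩⟩
  obtain ⟨L, hL⟩ := hω v hv
  obtain ⟨N₀, hN₀⟩ := exists_forall_recurrent_seg ω (L + 1 + y.length)
  obtain ⟨n₀, hn₀, hvn₀, hs₀⟩ := exists_autState_mem_avoidingStates hω hy hv N₀
  have key : ∀ N, ∃ n ≥ N, n₀ ≤ n ∧ OccursAt ω v n ∧
      autState f init ω n ∈ avoidingStates f ω y v ∧
      ∀ t, n₀ ≤ t → t < n → ¬ OccursAt (autOutput f init ω) y t := by
    intro N
    induction N with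
    | zero => exact ⟨n₀, by omega, le_rfl, hvn₀, hs₀, fun t _ _ => by omega⟩
    | succ N ih =>
      obtain ⟨n, hnN, hn, hvn, hs, hyn⟩ := ih
      obtain ⟨j, hj, hjL, hvj⟩ := hL (n + 1)
      obtain ⟨j', -, hjL', -⟩ := hL 0
      obtain ⟨d, rfl⟩ := Nat.exists_eq_add_of_le (show n ≤ j by omega)
      have hw := hN₀ n (by omega)
      have heq : avoidingStates f ω y (seg ω n (L + 1 + y.length)) = avoidingStates f ω y v :=
        Set.eq_of_subset_of_ncard_le (avoidingStates_seg_subset hvn (by omega))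
          (not_lt.mp (hmin _ hw)) (Set.toFinite _)
      rw [← heq] at hs
      obtain ⟨h1, h2⟩ := avoidingStates_step hs hvj (by omega) (by omega)
      refine ⟨n + d, by omega, by omega, hvj, h1, fun t ht htd => ?_⟩
      rcases lt_or_ge t n with htn | htn
      · exact hyn t ht htn
      · obtain ⟨s, rfl⟩ := Nat.exists_eq_add_of_le htn
        exact h2 s (by omega)
  obtain ⟨t, ht, hyt⟩ := hyrec n₀
  obtain ⟨n, hn, -, -, -, hyn⟩ := key (t + 1)
  exact hyn t ht (by omega) hyt
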